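/- arXiv:2604.04282 — 2 statements merged into one kernel-verified Lean document; each statement's English description precedes it below -/
import Mathlib

section
/- Let ε > 0 be a real number, and let 𝓗 be a finite set of horizontal lines and 𝓥 a finite set of vertical lines such that 𝓗 ∪ 𝓥 stabs 𝓡_F and |𝓗 ∪ 𝓥| ≤ 5k − εk. Let A be the set of all i ∈ {1,…,k} such that each of the strips ζ_v^{2i−2} and ζ_v^{2i−1} contains exactly one line of 𝓥 and each of the strips ζ_h^{2i−2} and ζ_h^{2i−1} contains exactly one line of 𝓗. Then |A| ≥ εk. -/
open Set MeasureTheory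

noncomputable section

/-- The horizontal line at height `y`. -/
def hline (y : ℝ) : Set (ℝ × ℝ) := {p : ℝ × ℝ | p.2 = y}

/-- The vertical line at abscissa `x`. -/
def vline (x : ℝ) : Set (ℝ × ℝ) := {p : ℝ × ℝ | p.1 = x}

/-- The axis-parallel rectangle `[a,b] × [c,d]`. -/
def rect (a b c d : ℝ) : Set (ℝ × ℝ) := Set.Icc a b ×ˢ Set.Icc c d

/-- A set is a (possibly degenerate) axis-parallel rectangle. -/
def IsRect (R : Set (ℝ × ℝ)) : Prop :=
  ∃ a b c d : ℝ, a ≤ b ∧ c ≤ d ∧ R = rect a b c d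

/-- A line `l` stabs a rectangle `R` if they intersect. -/
def Stabs (l R : Set (ℝ × ℝ)) : Prop := (R ∩ l).Nonempty

/-- A rectangle is stabbed by a set of lines if some line of the set stabs it. -/
def StabbedBy (L : Set (Set (ℝ × ℝ))) (R : Set (ℝ × ℝ)) : Prop :=
  ∃ l ∈ L, Stabs l R

/-- A set of lines stabs a set of rectangles if every rectangle is stabbed. -/
def StabsAll (L Rs : Set (Set (ℝ × ℝ))) : Prop := ∀ R ∈ Rs, StabbedBy L R

/-- All members are horizontal lines. -/
def IsHLineSet (H : Set (Set (ℝ × ℝ))) : Prop := ∀ l ∈ H, ∃ y : ℝ, l = hline y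

/-- All members are vertical lines. -/
def IsVLineSet (V : Set (Set (ℝ × ℝ))) : Prop := ∀ l ∈ V, ∃ x : ℝ, l = vline x

/-- `H'` is nicely positioned w.r.t. `H''`: for each line of `H'` at height `y`
there is a line of `H''` in the strip `ℝ × (y⁻, y]`, where `y⁻` is the largest
height of a line of `H'` below `y` (or `-∞`). -/
def NicelyPositioned (H' H'' : Set (Set (ℝ × ℝ))) : Prop :=
  ∀ y : ℝ, hline y ∈ H' →
    ∃ z : ℝ, hline z ∈ H'' ∧ z ≤ y ∧ ∀ y' : ℝ, hline y' ∈ H' → y' < y → y' < z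

/-- The open vertical strip `(a, b) × ℝ`. -/
def vstrip (a b : ℝ) : Set (ℝ × ℝ) := {p : ℝ × ℝ | a < p.1 ∧ p.1 < b}

/-- The open horizontal strip `ℝ × (a, b)`. -/
def hstrip (a b : ℝ) : Set (ℝ × ℝ) := {p : ℝ × ℝ | a < p.2 ∧ p.2 < b}

def IsVStrip (P : Set (ℝ × ℝ)) : Prop := ∃ a b : ℝ, a < b ∧ P = vstrip a b

def IsHStrip (P : Set (ℝ × ℝ)) : Prop := ∃ a b : ℝ, a < b ∧ P = hstrip a b

/-- The vertical line `l` separates `P` and `P'` (they lie on opposite sides). -/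
def SepByVLine (P P' l : Set (ℝ × ℝ)) : Prop :=
  ∃ x : ℝ, l = vline x ∧
    (((∀ p ∈ P, p.1 < x) ∧ (∀ p ∈ P', x < p.1)) ∨
     ((∀ p ∈ P', p.1 < x) ∧ (∀ p ∈ P, x < p.1)))

/-- The horizontal line `l` separates `P` and `P'`. -/
def SepByHLine (P P' l : Set (ℝ × ℝ)) : Prop :=
  ∃ y : ℝ, l = hline y ∧
    (((∀ p ∈ P, p.2 < y) ∧ (∀ p ∈ P', y < p.2)) ∨
     ((∀ p ∈ P', p.2 < y) ∧ (∀ p ∈ P, y < p.2)))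

/-- A family of vertical strips is separated by a set of vertical lines. -/
def VSeparated (Gam L : Set (Set (ℝ × ℝ))) : Prop :=
  (∀ P ∈ Gam, ∀ P' ∈ Gam, P ≠ P' → ∃ l ∈ L, SepByVLine P P' l) ∧
  (∀ P ∈ Gam, ∀ l ∈ L, P ∩ l = ∅)

/-- A family of horizontal strips is separated by a set of horizontal lines. -/
def HSeparated (Gam L : Set (Set (ℝ × ℝ))) : Prop :=
  (∀ P ∈ Gam, ∀ P' ∈ Gam, P ≠ P' → ∃ l ∈ L, SepByHLine P P' l) ∧
  (∀ P ∈ Gam, ∀ l ∈ L, P ∩ l = ∅)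

/-- `Γ(L)`: the connected components of the complement of the union of the lines of `L`. -/
def components (L : Set (Set (ℝ × ℝ))) : Set (Set (ℝ × ℝ)) :=
  {P | ∃ p ∈ (⋃ l ∈ L, l)ᶜ, P = connectedComponentIn ((⋃ l ∈ L, l)ᶜ) p}

/-- `B` is `Γ`-structured: a bijection `f : B → Γ` with `l ⊆ f l`. -/
def Structured (B Gam : Set (Set (ℝ × ℝ))) : Prop :=
  ∃ f : Set (ℝ × ℝ) → Set (ℝ × ℝ), Set.BijOn f B Gam ∧ ∀ l ∈ B, l ⊆ f l

/-- The closed vertical strip `ζ_v^x = [2r+xr+1, 2r+xr+r] × ℝ`. -/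
def zetaV (r x : ℕ) : Set (ℝ × ℝ) :=
  {p : ℝ × ℝ | 2*(r:ℝ) + (x:ℝ)*(r:ℝ) + 1 ≤ p.1 ∧ p.1 ≤ 2*(r:ℝ) + (x:ℝ)*(r:ℝ) + (r:ℝ)}

/-- The closed horizontal strip `ζ_h^x = ℝ × [2r+xr+1, 2r+xr+r]`. -/
def zetaH (r x : ℕ) : Set (ℝ × ℝ) :=
  {p : ℝ × ℝ | 2*(r:ℝ) + (x:ℝ)*(r:ℝ) + 1 ≤ p.2 ∧ p.2 ≤ 2*(r:ℝ) + (x:ℝ)*(r:ℝ) + (r:ℝ)}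

/-- The family `𝓡_F` of forcing rectangles. -/
def RF (k r : ℕ) : Set (Set (ℝ × ℝ)) :=
  {R | ∃ x : ℕ, x < 2*k ∧ ∃ q : ℤ, -(5*(k:ℤ)) ≤ q ∧ q ≤ -1 ∧
    (R = rect (2*(r:ℝ) + (x:ℝ)*(r:ℝ) + 1) (2*(r:ℝ) + (x:ℝ)*(r:ℝ) + (r:ℝ)) (q:ℝ) (q:ℝ) ∨
     R = rect (q:ℝ) (q:ℝ) (2*(r:ℝ) + (x:ℝ)*(r:ℝ) + 1) (2*(r:ℝ) + (x:ℝ)*(r:ℝ) + (r:ℝ)))}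

/-- The adjacency rectangle `A^{i,j}_{p,q}` (with real parameters `I = i`, `J = j`,
`P = p`, `Q = q`). -/
def Arect (r I J P Q : ℝ) : Set (ℝ × ℝ) :=
  rect (2*I*r + P + 1) (2*I*r + r + P - 1) (2*J*r + Q + 1) (2*J*r + r + Q - 1)

/-- The "top-left" equality rectangle `TL^{x,y}_a`. -/
def TLrect (r X Y A : ℝ) : Set (ℝ × ℝ) :=
  rect (2*r + X*r + 1) (2*r + X*r + A - 1) (2*r + Y*r + A) (2*r + Y*r + r)

/-- The "bottom-right" equality rectangle `BR^{x,y}_a`. -/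
def BRrect (r X Y A : ℝ) : Set (ℝ × ℝ) :=
  rect (2*r + X*r + A) (2*r + X*r + r) (2*r + Y*r + 1) (2*r + Y*r + A - 1)

/-- The family `𝓡_A` encoding non-adjacency; vertex `v^i_p` is `(i-1, p-1) : Fin k × Fin r`. -/
def RA (k r : ℕ) (G : SimpleGraph (Fin k × Fin r)) : Set (Set (ℝ × ℝ)) :=
  {R | ∃ i j : Fin k, i ≠ j ∧ ∃ p q : Fin r, ¬ G.Adj (i, p) (j, q) ∧
    R = Arect (r:ℝ) ((i:ℕ)+1 : ℝ) ((j:ℕ)+1 : ℝ) ((p:ℕ)+1 : ℝ) ((q:ℕ)+1 : ℝ)}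

/-- The family `𝓡_E` of equality rectangles. -/
def RE (k r : ℕ) : Set (Set (ℝ × ℝ)) :=
  {R | ∃ x y : ℕ, x < 2*k ∧ y < 2*k ∧ x / 2 = y / 2 ∧ ∃ a : ℕ, 2 ≤ a ∧ a ≤ r ∧
    (R = TLrect (r:ℝ) (x:ℝ) (y:ℝ) (a:ℝ) ∨ R = BRrect (r:ℝ) (x:ℝ) (y:ℝ) (a:ℝ))}

/-- A multicolored clique: a clique meeting each color class `{i} × Fin r` at most once. -/
def IsMulticoloredClique {k r : ℕ} (G : SimpleGraph (Fin k × Fin r))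
    (C : Finset (Fin k × Fin r)) : Prop :=
  G.IsClique (C : Set (Fin k × Fin r)) ∧
  ∀ u ∈ C, ∀ w ∈ C, u.1 = w.1 → u = w

theorem aux_sum (L : Set (Set (ℝ × ℝ))) (hfin : L.Finite) (Z : ℕ → Set (ℝ × ℝ))
    (hne : ∀ l ∈ L, l.Nonempty) (hZ : ∀ x y, x < y → Disjoint (Z x) (Z y)) (n : ℕ) :
    ∑ x ∈ Finset.range n, {l | l ∈ L ∧ l ⊆ Z x}.ncard ≤ L.ncard := by
  classical
  have h1 : ∀ x, {l | l ∈ L ∧ l ⊆ Z x}.ncard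
      = (hfin.toFinset.filter (fun l => l ⊆ Z x)).card := by
    intro x
    rw [← Set.ncard_coe_finset]
    congr 1
    ext l
    simp
  simp_rw [h1]
  rw [← Finset.card_biUnion, Set.ncard_eq_toFinset_card L hfin]
  · apply Finset.card_le_card
    intro l hl
    simp only [Finset.mem_biUnion, Finset.mem_filter] at hl
    obtain ⟨x, _, h, _⟩ := hl
    exact h
  · intro x _ y _ hxy
    rw [Function.onFun, Finset.disjoint_left]
    intro l hx hy
    simp only [Finset.mem_filter, Set.Finite.mem_toFinset] at hx hy
    obtain ⟨p, hp⟩ := hne l hx.1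
    rcases lt_or_gt_of_ne hxy with h | h
    · exact Set.disjoint_left.1 (hZ x y h) (hx.2 hp) (hy.2 hp)
    · exact Set.disjoint_left.1 (hZ y x h) (hy.2 hp) (hx.2 hp)

theorem aux_pair (f : ℕ → ℕ) (k : ℕ) :
    ∑ i ∈ Finset.Icc 1 k, (f (2*i-2) + f (2*i-1)) = ∑ x ∈ Finset.range (2*k), f x := by
  induction k with
  | zero => simp
  | succ k ih =>
    rw [Finset.sum_Icc_succ_top (by omega), ih, show 2*(k+1) = 2*k+1+1 by ring,
      Finset.sum_range_succ, Finset.sum_range_succ]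
    simp only [Nat.add_sub_cancel, show 2*k+1+1-2 = 2*k by omega]
    ring

theorem aux_uniq (L : Set (Set (ℝ × ℝ))) (Z : Set (ℝ × ℝ))
    (h : {l | l ∈ L ∧ l ⊆ Z}.ncard = 1) : ∃! l, l ∈ L ∧ l ⊆ Z := by
  obtain ⟨a, ha⟩ := Set.ncard_eq_one.1 h
  have hm : ∀ l, (l ∈ L ∧ l ⊆ Z) ↔ l = a := fun l => by
    have := Set.ext_iff.1 ha l
    simpa using this
  exact ⟨a, (hm a).2 rfl, fun l hl => (hm l).1 hl⟩

theorem aux_many (L : Set (Set (ℝ × ℝ))) (hfin : L.Finite) (g : ℤ → Set (ℝ × ℝ))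
    (hg : Function.Injective g) (k : ℕ)
    (h : ∀ q : ℤ, -(5*(k:ℤ)) ≤ q → q ≤ -1 → g q ∈ L) : 5 * k ≤ L.ncard := by
  have h1 : g '' (Set.Icc (-(5*(k:ℤ))) (-1)) ⊆ L := by
    rintro _ ⟨q, hq, rfl⟩
    exact h q hq.1 hq.2
  have h2 := Set.ncard_le_ncard h1 hfin
  rw [Set.ncard_image_of_injective _ hg, ← Finset.coe_Icc, Set.ncard_coe_finset,
    Int.card_Icc] at h2
  omega

theorem strip_aux (r : ℕ) (x y : ℕ) (h : x < y) (t : ℝ)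
    (h1 : t ≤ 2*(r:ℝ) + (x:ℝ)*(r:ℝ) + (r:ℝ)) (h2 : 2*(r:ℝ) + (y:ℝ)*(r:ℝ) + 1 ≤ t) : False := by
  have h3 : (x:ℝ) + 1 ≤ y := by exact_mod_cast h
  nlinarith [(Nat.cast_nonneg r : (0:ℝ) ≤ r)]

theorem stmt13 (k r : ℕ) (hk : 1 ≤ k) (hr : 2 ≤ r)
    (ε : ℝ) (hε : 0 < ε)
    (H V : Set (Set (ℝ × ℝ)))
    (hHfin : H.Finite) (hH : IsHLineSet H)
    (hVfin : V.Finite) (hV : IsVLineSet V)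
    (hstab : StabsAll (H ∪ V) (RF k r))
    (hcard : ((H ∪ V).ncard : ℝ) ≤ 5 * k - ε * k) :
    ε * k ≤ (({i : ℕ | 1 ≤ i ∧ i ≤ k ∧
        (∃! l, l ∈ V ∧ l ⊆ zetaV r (2*i - 2)) ∧
        (∃! l, l ∈ V ∧ l ⊆ zetaV r (2*i - 1)) ∧
        (∃! l, l ∈ H ∧ l ⊆ zetaH r (2*i - 2)) ∧
        (∃! l, l ∈ H ∧ l ⊆ zetaH r (2*i - 1))}).ncard : ℝ) := by
  classical
  have hkpos : (0:ℝ) < k := by exact_mod_cast hk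
  have hlt : (H ∪ V).ncard < 5 * k := by
    have : ((H ∪ V).ncard : ℝ) < 5 * k := by nlinarith
    exact_mod_cast this
  have hfin : (H ∪ V).Finite := hHfin.union hVfin
  have hinjH : Function.Injective (fun q : ℤ => hline (q:ℝ)) := by
    intro a b hab
    have : ((0:ℝ), (a:ℝ)) ∈ hline (b:ℝ) := by
      have h0 : ((0:ℝ), (a:ℝ)) ∈ hline (a:ℝ) := rfl
      rw [show hline (a:ℝ) = hline (b:ℝ) from hab] at h0
      exact h0
    have h1 : (a:ℝ) = b := this
    exact_mod_cast h1
  have hinjV : Function.Injective (fun q : ℤ => vline (q:ℝ)) := by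
    intro a b hab
    have : ((a:ℝ), (0:ℝ)) ∈ vline (b:ℝ) := by
      have h0 : ((a:ℝ), (0:ℝ)) ∈ vline (a:ℝ) := rfl
      rw [show vline (a:ℝ) = vline (b:ℝ) from hab] at h0
      exact h0
    have h1 : (a:ℝ) = b := this
    exact_mod_cast h1
  have hv : ∀ x, x < 2*k → 1 ≤ {l | l ∈ V ∧ l ⊆ zetaV r x}.ncard := by
    intro x hx
    rw [Nat.one_le_iff_ne_zero]
    intro h0
    rw [Set.ncard_eq_zero (hVfin.subset (fun l hl => hl.1))] at h0
    refine absurd (aux_many (H ∪ V) hfin _ hinjH k ?_) (not_le.2 hlt)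
    intro q hq1 hq2
    obtain ⟨l, hl, p, hp, hpl⟩ := hstab _ ⟨x, hx, q, hq1, hq2, Or.inl rfl⟩
    simp only [rect, Set.mem_prod, Set.mem_Icc] at hp
    rcases hl with hl | hl
    · obtain ⟨y, rfl⟩ := hH l hl
      have e1 : p.2 = y := hpl
      have e2 : y = (q:ℝ) := by rw [← e1]; exact le_antisymm hp.2.2 hp.2.1
      rw [e2] at hl
      exact Or.inl hl
    · exfalso
      have : l ∈ {l | l ∈ V ∧ l ⊆ zetaV r x} := by
        refine ⟨hl, ?_⟩
        obtain ⟨y, rfl⟩ := hV l hl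
        intro p' hp'
        have e1 : p.1 = y := hpl
        have e2 : p'.1 = y := hp'
        simp only [zetaV, Set.mem_setOf_eq, e2, ← e1]
        exact hp.1
      rw [h0] at this
      exact this
  have hh : ∀ x, x < 2*k → 1 ≤ {l | l ∈ H ∧ l ⊆ zetaH r x}.ncard := by
    intro x hx
    rw [Nat.one_le_iff_ne_zero]
    intro h0
    rw [Set.ncard_eq_zero (hHfin.subset (fun l hl => hl.1))] at h0
    refine absurd (aux_many (H ∪ V) hfin _ hinjV k ?_) (not_le.2 hlt)
    intro q hq1 hq2
    obtain ⟨l, hl, p, hp, hpl⟩ := hstab _ ⟨x, hx, q, hq1, hq2, Or.inr rfl⟩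
    simp only [rect, Set.mem_prod, Set.mem_Icc] at hp
    rcases hl with hl | hl
    · exfalso
      have : l ∈ {l | l ∈ H ∧ l ⊆ zetaH r x} := by
        refine ⟨hl, ?_⟩
        obtain ⟨y, rfl⟩ := hH l hl
        intro p' hp'
        have e1 : p.2 = y := hpl
        have e2 : p'.2 = y := hp'
        simp only [zetaH, Set.mem_setOf_eq, e2, ← e1]
        exact hp.2
      rw [h0] at this
      exact this
    · obtain ⟨y, rfl⟩ := hV l hl
      have e1 : p.1 = y := hpl
      have e2 : y = (q:ℝ) := by rw [← e1]; exact le_antisymm hp.1.2 hp.1.1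
      rw [e2] at hl
      exact Or.inr hl
  have hdisj : Disjoint H V := by
    rw [Set.disjoint_left]
    intro l h1 h2
    obtain ⟨y, rfl⟩ := hH l h1
    obtain ⟨x, e⟩ := hV _ h2
    have h3 : (x + 1, y) ∈ hline y := rfl
    rw [e] at h3
    have h4 : x + 1 = x := h3
    linarith
  have hcu := Set.ncard_union_eq hdisj hHfin hVfin
  have sV := aux_sum V hVfin (zetaV r)
    (by
      intro l hl
      obtain ⟨x, rfl⟩ := hV l hl
      exact ⟨(x, 0), rfl⟩)
    (by
      intro x y hxy
      rw [Set.disjoint_left]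
      intro p h1 h2
      exact strip_aux r x y hxy _ h1.2 h2.1) (2*k)
  have sH := aux_sum H hHfin (zetaH r)
    (by
      intro l hl
      obtain ⟨x, rfl⟩ := hH l hl
      exact ⟨(0, x), rfl⟩)
    (by
      intro x y hxy
      rw [Set.disjoint_left]
      intro p h1 h2
      exact strip_aux r x y hxy _ h1.2 h2.1) (2*k)
  rw [← aux_pair] at sV sH
  set A := {i : ℕ | 1 ≤ i ∧ i ≤ k ∧
        (∃! l, l ∈ V ∧ l ⊆ zetaV r (2*i - 2)) ∧
        (∃! l, l ∈ V ∧ l ⊆ zetaV r (2*i - 1)) ∧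
        (∃! l, l ∈ H ∧ l ⊆ zetaH r (2*i - 2)) ∧
        (∃! l, l ∈ H ∧ l ⊆ zetaH r (2*i - 1))} with hA
  have hAc : A.ncard = ∑ i ∈ Finset.Icc 1 k, if i ∈ A then 1 else 0 := by
    rw [← Finset.card_filter, ← Set.ncard_coe_finset]
    congr 1
    ext i
    simp only [Finset.coe_filter, Finset.mem_Icc, Set.mem_setOf_eq]
    exact ⟨fun h => ⟨⟨h.1, h.2.1⟩, h⟩, fun h => h.2⟩
  have key : ∑ i ∈ Finset.Icc 1 k, 5 ≤ ∑ i ∈ Finset.Icc 1 k,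
      (({l | l ∈ V ∧ l ⊆ zetaV r (2*i-2)}.ncard + {l | l ∈ V ∧ l ⊆ zetaV r (2*i-1)}.ncard)
      + ({l | l ∈ H ∧ l ⊆ zetaH r (2*i-2)}.ncard + {l | l ∈ H ∧ l ⊆ zetaH r (2*i-1)}.ncard)
      + if i ∈ A then 1 else 0) := by
    apply Finset.sum_le_sum
    intro i hi
    rw [Finset.mem_Icc] at hi
    have a1 := hv (2*i-2) (by omega)
    have a2 := hv (2*i-1) (by omega)
    have a3 := hh (2*i-2) (by omega)
    have a4 := hh (2*i-1) (by omega)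
    split_ifs with hiA
    · omega
    · by_contra hcon
      exact hiA ⟨hi.1, hi.2, aux_uniq _ _ (by omega), aux_uniq _ _ (by omega),
        aux_uniq _ _ (by omega), aux_uniq _ _ (by omega)⟩
  rw [Finset.sum_add_distrib, Finset.sum_add_distrib, ← hAc] at key
  simp only [Finset.sum_const, Nat.card_Icc, smul_eq_mul, Nat.add_sub_cancel] at key
  have fin : k * 5 ≤ (H ∪ V).ncard + A.ncard := by omega
  have fin' : (k:ℝ) * 5 ≤ ((H ∪ V).ncard : ℝ) + (A.ncard : ℝ) := by exact_mod_cast fin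
  linarith
end
end

section
/- Let 𝓡 be a finite set of rectangles all of whose corner coordinates are integers, and let 𝓡' = { [2a, 2b+1] × [2c, 2d+1] : [a,b] × [c,d] ∈ 𝓡 }. Let 𝓗' be a set of horizontal lines and 𝓥' a set of vertical lines, all at integer positions. Then 𝓗' ∪ 𝓥' stabs 𝓡' if and only if the set { ℓ_h^{⌊y/2⌋} : ℓ_h^y ∈ 𝓗' } ∪ { ℓ_v^{⌊x/2⌋} : ℓ_v^x ∈ 𝓥' } stabs 𝓡. -/
open Set MeasureTheory

noncomputable section

theorem aux_h (a b c d : ℝ) (y : ℝ) (hab : a ≤ b) :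
    Stabs (hline y) (rect a b c d) ↔ c ≤ y ∧ y ≤ d := by
  constructor
  · rintro ⟨p, ⟨_, hp⟩, hl⟩
    have hl : p.2 = y := hl
    rw [← hl]; exact hp
  · intro h
    exact ⟨(a, y), ⟨⟨le_refl a, hab⟩, h⟩, rfl⟩

theorem aux_v (a b c d : ℝ) (x : ℝ) (hcd : c ≤ d) :
    Stabs (vline x) (rect a b c d) ↔ a ≤ x ∧ x ≤ b := by
  constructor
  · rintro ⟨p, ⟨hp, _⟩, hl⟩
    have hl : p.1 = x := hl
    rw [← hl]; exact hp
  · intro h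
    exact ⟨(x, c), ⟨h, ⟨le_refl c, hcd⟩⟩, rfl⟩

theorem aux_floor (c d y : ℤ) :
    (2 * (c:ℝ) ≤ (y:ℝ) ∧ (y:ℝ) ≤ 2 * (d:ℝ) + 1) ↔
    ((c:ℝ) ≤ ((⌊(y : ℝ) / 2⌋ : ℤ) : ℝ) ∧ ((⌊(y : ℝ) / 2⌋ : ℤ) : ℝ) ≤ (d:ℝ)) := by
  have h1 := Int.floor_le ((y:ℝ)/2)
  have h2 := Int.lt_floor_add_one ((y:ℝ)/2)
  generalize ⌊(y : ℝ) / 2⌋ = k at *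
  have h3 : 2 * (k:ℝ) ≤ y := by linarith
  have h4 : (y:ℝ) < 2 * k + 2 := by linarith
  norm_cast at *
  omega

theorem aux_main (H' V' : Set (Set (ℝ × ℝ)))
    (hH' : ∀ l ∈ H', ∃ y : ℤ, l = hline (y : ℝ))
    (hV' : ∀ l ∈ V', ∃ x : ℤ, l = vline (x : ℝ)) (a b c d : ℤ) (hab : a ≤ b) (hcd : c ≤ d) :
    StabbedBy (H' ∪ V') (rect (2*(a:ℝ)) (2*(b:ℝ) + 1) (2*(c:ℝ)) (2*(d:ℝ) + 1)) ↔
    StabbedBy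
      ({l | ∃ y : ℤ, hline (y : ℝ) ∈ H' ∧ l = hline ((⌊(y : ℝ) / 2⌋ : ℤ) : ℝ)} ∪
       {l | ∃ x : ℤ, vline (x : ℝ) ∈ V' ∧ l = vline ((⌊(x : ℝ) / 2⌋ : ℤ) : ℝ)})
      (rect (a:ℝ) (b:ℝ) (c:ℝ) (d:ℝ)) := by
  have hab1 : (a:ℝ) ≤ b := by exact_mod_cast hab
  have hcd1 : (c:ℝ) ≤ d := by exact_mod_cast hcd
  have hab2 : 2*(a:ℝ) ≤ 2*b+1 := by linarith
  have hcd2 : 2*(c:ℝ) ≤ 2*d+1 := by linarith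
  constructor
  · rintro ⟨l, hl | hl, hs⟩
    · obtain ⟨y, rfl⟩ := hH' l hl
      refine ⟨_, Or.inl ⟨y, hl, rfl⟩, ?_⟩
      rw [aux_h _ _ _ _ _ hab2, aux_floor] at hs
      rwa [aux_h _ _ _ _ _ hab1]
    · obtain ⟨y, rfl⟩ := hV' l hl
      refine ⟨_, Or.inr ⟨y, hl, rfl⟩, ?_⟩
      rw [aux_v _ _ _ _ _ hcd2, aux_floor] at hs
      rwa [aux_v _ _ _ _ _ hcd1]
  · rintro ⟨l, ⟨y, hl, rfl⟩ | ⟨y, hl, rfl⟩, hs⟩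
    · refine ⟨_, Or.inl hl, ?_⟩
      rw [aux_h _ _ _ _ _ hab1, ← aux_floor] at hs
      rwa [aux_h _ _ _ _ _ hab2]
    · refine ⟨_, Or.inr hl, ?_⟩
      rw [aux_v _ _ _ _ _ hcd1, ← aux_floor] at hs
      rwa [aux_v _ _ _ _ _ hcd2]

theorem stmt14 (R R' H' V' : Set (Set (ℝ × ℝ)))
    (hRfin : R.Finite)
    (hR : ∀ S ∈ R, ∃ a b c d : ℤ, a ≤ b ∧ c ≤ d ∧ S = rect (a:ℝ) (b:ℝ) (c:ℝ) (d:ℝ))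
    (hR' : R' = {S | ∃ a b c d : ℤ, a ≤ b ∧ c ≤ d ∧ rect (a:ℝ) (b:ℝ) (c:ℝ) (d:ℝ) ∈ R ∧
      S = rect (2*(a:ℝ)) (2*(b:ℝ) + 1) (2*(c:ℝ)) (2*(d:ℝ) + 1)})
    (hH' : ∀ l ∈ H', ∃ y : ℤ, l = hline (y : ℝ))
    (hV' : ∀ l ∈ V', ∃ x : ℤ, l = vline (x : ℝ)) :
    StabsAll (H' ∪ V') R' ↔
    StabsAll
      ({l | ∃ y : ℤ, hline (y : ℝ) ∈ H' ∧ l = hline ((⌊(y : ℝ) / 2⌋ : ℤ) : ℝ)} ∪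
       {l | ∃ x : ℤ, vline (x : ℝ) ∈ V' ∧ l = vline ((⌊(x : ℝ) / 2⌋ : ℤ) : ℝ)}) R := by
  subst hR'
  constructor
  · intro h S hS
    obtain ⟨a, b, c, d, hab, hcd, rfl⟩ := hR S hS
    exact (aux_main H' V' hH' hV' a b c d hab hcd).1 (h _ ⟨a, b, c, d, hab, hcd, hS, rfl⟩)
  · rintro h S ⟨a, b, c, d, hab, hcd, hS, rfl⟩
    exact (aux_main H' V' hH' hV' a b c d hab hcd).2 (h _ hS)
end
end
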